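/- Let I be one of the intervals (τ,σ), (τ,σ], [τ,σ), [τ,σ] with −∞ ≤ τ < σ ≤ ∞. Suppose α(t) ≠ 0 for all t ∈ I and there exists a C¹ solution ρ : I → ℂ of the Riccati equation (R). Suppose the integrals f₃(t) = ∫_τ^t e^{∫_s^t Re(ρ(μ)) dμ} ds and f₄(t) = ∫_τ^t ( e^{−∫_s^t Re(ρ(μ) + β(μ)/α(μ)) dμ} / |α(s)| ) ds converge for all t ∈ I, and that sup_{t∈I} f₃(t) < ∞ and sup_{t∈I} f₄(t) < ∞. Then (E) is Ulam stable on I, and L₃ = sup_{t∈I} ∫_τ^t ( ∫_τ^s ( e^{−∫_μ^s Re(ρ(ν) + β(ν)/α(ν)) dν} / |α(μ)| ) dμ ) e^{∫_s^t Re(ρ(μ)) dμ} ds is an Ulam constant for (E) on I. -/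

import Mathlib

open MeasureTheory Set

/-- The set of real numbers strictly between the extended real `τ` and `t`. -/
def EIoo (τ : EReal) (t : ℝ) : Set ℝ := {s : ℝ | τ < (s : EReal) ∧ s < t}

/-- The function `f₃(t) = ∫_τ^t e^{∫_s^t Re(ρ) dμ} ds`. -/
noncomputable def f₃ (τ : EReal) (ρ : ℝ → ℂ) (t : ℝ) : ℝ :=
  ∫ s in EIoo τ t, Real.exp (∫ μ in s..t, (ρ μ).re)

/-- The function `f₄(t) = ∫_τ^t e^{-∫_s^t Re(ρ + β/α) dμ} / |α(s)| ds`. -/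
noncomputable def f₄ (τ : EReal) (α β ρ : ℝ → ℂ) (t : ℝ) : ℝ :=
  ∫ s in EIoo τ t, Real.exp (-∫ μ in s..t, (ρ μ + β μ / α μ).re) / ‖α s‖

/-- `L` is an Ulam constant for `α(t)x'' + β(t)x' + γ(t)x = f(t)` on `I`:
`L > 0` and for every `ε > 0` and every C² function `ξ` with
`sup_{t∈I} ‖α ξ'' + β ξ' + γ ξ - f‖ ≤ ε` there is a solution `x` of the equation on `I`
with `sup_{t∈I} ‖ξ - x‖ ≤ L ε`. -/
def IsUlamConstant (n : ℕ) (I : Set ℝ) (α β γ : ℝ → ℂ)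
    (f : ℝ → EuclideanSpace ℂ (Fin n)) (L : ℝ) : Prop :=
  0 < L ∧ ∀ ε > 0, ∀ ξ ξd ξdd : ℝ → EuclideanSpace ℂ (Fin n),
    (∀ t ∈ I, HasDerivWithinAt ξ (ξd t) I t) →
    (∀ t ∈ I, HasDerivWithinAt ξd (ξdd t) I t) →
    ContinuousOn ξdd I →
    (∀ t ∈ I, ‖α t • ξdd t + β t • ξd t + γ t • ξ t - f t‖ ≤ ε) →
    ∃ x xd xdd : ℝ → EuclideanSpace ℂ (Fin n),
      (∀ t ∈ I, HasDerivWithinAt x (xd t) I t) ∧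
      (∀ t ∈ I, HasDerivWithinAt xd (xdd t) I t) ∧
      ContinuousOn xdd I ∧
      (∀ t ∈ I, α t • xdd t + β t • xd t + γ t • x t = f t) ∧
      ∀ t ∈ I, ‖ξ t - x t‖ ≤ L * ε

theorem measurableSet_EIoo (τ : EReal) (t : ℝ) : MeasurableSet (EIoo τ t) :=
  (measurableSet_lt measurable_const measurable_coe_real_ereal).inter measurableSet_Iio

theorem isOpen_EIoo (τ : EReal) (t : ℝ) : IsOpen (EIoo τ t) :=
  (isOpen_lt continuous_const continuous_coe_real_ereal).inter isOpen_Iio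

theorem volume_EIoo_pos {τ : EReal} {t : ℝ} (h : τ < t) : 0 < volume (EIoo τ t) := by
  obtain ⟨q, hq₁, hq₂⟩ := EReal.lt_iff_exists_real_btwn.1 h
  exact (isOpen_EIoo τ t).measure_pos volume ⟨q, hq₁, EReal.coe_lt_coe_iff.1 hq₂⟩

theorem EIoo_ae_eq (τ : EReal) (t : ℝ) :
    EIoo τ t =ᵐ[volume] ({s : ℝ | τ < (s : EReal)} ∩ Iic t : Set ℝ) :=
  (Filter.EventuallyEq.refl _ _).inter Iio_ae_eq_Iic

/-- Strict positivity of the integral of a positive function over `EIoo τ t`. -/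
theorem setIntegral_EIoo_pos {τ : EReal} {t : ℝ} {g : ℝ → ℝ} (h : τ < t)
    (hg : ∀ s ∈ EIoo τ t, 0 < g s) (hint : IntegrableOn g (EIoo τ t)) :
    0 < ∫ s in EIoo τ t, g s := by
  rw [setIntegral_pos_iff_support_of_nonneg_ae _ hint]
  · refine (volume_EIoo_pos h).trans_le (measure_mono fun s hs => ⟨(hg s hs).ne', hs⟩)
  · exact (ae_restrict_iff' (measurableSet_EIoo τ t)).2 (.of_forall fun s hs => (hg s hs).le)

theorem ContinuousOn.intervalIntegrable_of_ordConnected {E : Type*}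
    [NormedAddCommGroup E] {I : Set ℝ} (hI : I.OrdConnected)
    {g : ℝ → E} (hg : ContinuousOn g I) {a b : ℝ} (ha : a ∈ I) (hb : b ∈ I) :
    IntervalIntegrable g volume a b :=
  (hg.mono (hI.uIcc_subset ha hb)).intervalIntegrable

section

variable {E : Type*} [NormedAddCommGroup E] [NormedSpace ℝ E]

/-- Splitting an integral from `τ` to `b` at `a`. -/
theorem setIntegral_EIoo_sub {τ : EReal} {a b : ℝ} (hτ : τ ≤ a) (hab : a ≤ b) {g : ℝ → E}
    (hg : IntegrableOn g (EIoo τ b)) :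
    ∫ s in EIoo τ b, g s = (∫ s in EIoo τ a, g s) + ∫ s in a..b, g s := by
  have hm : MeasurableSet {s : ℝ | τ < (s : EReal)} :=
    measurableSet_lt measurable_const measurable_coe_real_ereal
  have hunion : ({s : ℝ | τ < (s : EReal)} ∩ Iic b : Set ℝ)
      = ({s : ℝ | τ < (s : EReal)} ∩ Iic a) ∪ Ioc a b := by
    ext s
    simp only [mem_inter_iff, mem_ofPred_eq, mem_Iic, mem_union, mem_Ioc]
    constructor
    · rintro ⟨h₁, h₂⟩
      rcases le_or_gt s a with h | h
      exacts [Or.inl ⟨h₁, h⟩, Or.inr ⟨h, h₂⟩]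
    · rintro (⟨h₁, h₂⟩ | ⟨h₁, h₂⟩)
      exacts [⟨h₁, h₂.trans hab⟩, ⟨hτ.trans_lt (EReal.coe_lt_coe_iff.2 h₁), h₂⟩]
  have hg' : IntegrableOn g ({s : ℝ | τ < (s : EReal)} ∩ Iic b) :=
    hg.congr_set_ae (EIoo_ae_eq τ b).symm
  rw [hunion] at hg'
  rw [setIntegral_congr_set (EIoo_ae_eq τ b), setIntegral_congr_set (EIoo_ae_eq τ a), hunion,
    setIntegral_union _ measurableSet_Ioc hg'.left_of_union hg'.right_of_union,
    intervalIntegral.integral_of_le hab]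
  exact Set.disjoint_left.2 fun s hs hs' => not_lt.2 hs.2 hs'.1

theorem setIntegral_EIoo_eq_add {τ : EReal} {a b : ℝ} (ha : τ ≤ a) (hb : τ ≤ b) {g : ℝ → E}
    (hga : IntegrableOn g (EIoo τ a)) (hgb : IntegrableOn g (EIoo τ b)) :
    ∫ s in EIoo τ b, g s = (∫ s in EIoo τ a, g s) + ∫ s in a..b, g s := by
  rcases le_total a b with h | h
  · exact setIntegral_EIoo_sub ha h hgb
  · rw [setIntegral_EIoo_sub hb h hga, intervalIntegral.integral_symm a b]
    abel

/-- The fundamental theorem of calculus relative to an arbitrary interval. -/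
theorem hasDerivWithinAt_integral_of_ordConnected [CompleteSpace E] {I : Set ℝ}
    (hI : I.OrdConnected) {g : ℝ → E} (hg : ContinuousOn g I) {a t : ℝ} (ha : a ∈ I)
    (ht : t ∈ I) : HasDerivWithinAt (fun x => ∫ s in a..x, g s) (g t) I t := by
  rw [hasDerivWithinAt_iff_isLittleO, Asymptotics.isLittleO_iff]
  intro c hc
  obtain ⟨δ, hδ, hball⟩ := Metric.continuousWithinAt_iff.1 (hg t ht) c hc
  filter_upwards [self_mem_nhdsWithin, mem_nhdsWithin_of_mem_nhds (Metric.ball_mem_nhds t hδ)]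
    with x hx hxδ
  have hint := hg.intervalIntegrable_of_ordConnected hI ht hx
  have hconst : (x - t) • g t = ∫ _ in t..x, g t := by simp
  rw [intervalIntegral.integral_interval_sub_left
    (hg.intervalIntegrable_of_ordConnected hI ha hx)
    (hg.intervalIntegrable_of_ordConnected hI ha ht), hconst,
    ← intervalIntegral.integral_sub hint intervalIntegrable_const]
  refine intervalIntegral.norm_integral_le_of_norm_le_const fun s hs => ?_
  have hs' := uIoc_subset_uIcc hs
  rw [← dist_eq_norm]
  refine (hball (hI.uIcc_subset ht hx hs') ?_).le
  rw [Real.dist_eq]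
  exact (abs_sub_left_of_mem_uIcc hs').trans_lt hxδ

end

theorem re_intervalIntegral {p : ℝ → ℂ} {a b : ℝ} (hp : IntervalIntegrable p volume a b) :
    (∫ s in a..b, p s).re = ∫ s in a..b, (p s).re :=
  (Complex.reCLM.intervalIntegral_comp_comm hp).symm

theorem norm_exp_intervalIntegral {p : ℝ → ℂ} {a b : ℝ} (hp : IntervalIntegrable p volume a b) :
    ‖Complex.exp (∫ s in a..b, p s)‖ = Real.exp (∫ s in a..b, (p s).re) := by
  rw [Complex.norm_exp, re_intervalIntegral hp]

section

variable {E : Type*} [NormedAddCommGroup E] [NormedSpace ℂ E]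

/-- The solution of `u' = p u + h` given by variation of constants starting from `τ`. -/
noncomputable def duhamel (τ : EReal) (p : ℝ → ℂ) (h : ℝ → E) (t : ℝ) : E :=
  ∫ s in EIoo τ t, Complex.exp (∫ μ in s..t, p μ) • h s

theorem norm_duhamel_le {τ : EReal} {I : Set ℝ} (hI : I.OrdConnected)
    (hsub : ∀ t ∈ I, EIoo τ t ⊆ I) {p : ℝ → ℂ} {h : ℝ → E} {b : ℝ → ℝ} (hp : ContinuousOn p I)
    (hb : ∀ t ∈ I, ‖h t‖ ≤ b t) (hint : ∀ t ∈ I, IntegrableOn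
      (fun s => Real.exp (∫ μ in s..t, (p μ).re) * b s) (EIoo τ t)) {t : ℝ} (ht : t ∈ I) :
    ‖duhamel τ p h t‖ ≤ ∫ s in EIoo τ t, Real.exp (∫ μ in s..t, (p μ).re) * b s := by
  refine norm_integral_le_of_norm_le (hint t ht)
    ((ae_restrict_iff' (measurableSet_EIoo τ t)).2 (.of_forall fun s hs => ?_))
  have hs' := hsub t ht hs
  rw [norm_smul, norm_exp_intervalIntegral (hp.intervalIntegrable_of_ordConnected hI hs' ht)]
  gcongr
  exact hb s hs'

theorem hasDerivWithinAt_duhamel [CompleteSpace E] {τ : EReal} {I : Set ℝ}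
    (hI : I.OrdConnected) (hsub : ∀ t ∈ I, EIoo τ t ⊆ I) {p : ℝ → ℂ} {h : ℝ → E} {b : ℝ → ℝ}
    (hp : ContinuousOn p I) (hh : ContinuousOn h I) (hb : ∀ t ∈ I, ‖h t‖ ≤ b t)
    (hint : ∀ t ∈ I, IntegrableOn
      (fun s => Real.exp (∫ μ in s..t, (p μ).re) * b s) (EIoo τ t))
    (hτ : ∀ t ∈ I, τ ≤ t) {t : ℝ} (ht : t ∈ I) :
    HasDerivWithinAt (duhamel τ p h) (p t • duhamel τ p h t + h t) I t := by
  set P : ℝ → ℂ := fun x => ∫ s in t..x, p s with hP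
  have hPd : ∀ x ∈ I, HasDerivWithinAt P (p x) I x := fun x hx =>
    hasDerivWithinAt_integral_of_ordConnected hI hp ht hx
  have hPc : ContinuousOn P I := fun x hx => (hPd x hx).continuousWithinAt
  set g : ℝ → E := fun s => Complex.exp (-P s) • h s with hg
  have hgc : ContinuousOn g I := hPc.neg.cexp.smul hh
  have hfactor : ∀ x ∈ I, ∀ s ∈ I,
      Complex.exp (∫ μ in s..x, p μ) = Complex.exp (P x) * Complex.exp (-P s) := by
    intro x hx s hs
    rw [← Complex.exp_add, ← sub_eq_add_neg, hP, intervalIntegral.integral_interval_sub_left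
      (hp.intervalIntegrable_of_ordConnected hI ht hx)
      (hp.intervalIntegrable_of_ordConnected hI ht hs)]
  have hgi : ∀ x ∈ I, IntegrableOn g (EIoo τ x) := by
    intro x hx
    refine ((hint x hx).const_mul ‖Complex.exp (-P x)‖).mono'
      ((hgc.mono (hsub x hx)).aestronglyMeasurable (measurableSet_EIoo τ x))
      ((ae_restrict_iff' (measurableSet_EIoo τ x)).2 (.of_forall fun s hs => ?_))
    have hs' := hsub x hx hs
    have hexp : Complex.exp (-P s)
        = Complex.exp (-P x) * Complex.exp (∫ μ in s..x, p μ) := by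
      rw [hfactor x hx s hs', ← mul_assoc, ← Complex.exp_add, neg_add_cancel, Complex.exp_zero,
        one_mul]
    rw [hg, norm_smul, hexp, norm_mul, mul_assoc,
      norm_exp_intervalIntegral (hp.intervalIntegrable_of_ordConnected hI hs' hx)]
    gcongr
    exact hb s hs'
  have hu : ∀ x ∈ I, duhamel τ p h x
      = Complex.exp (P x) • ((∫ s in EIoo τ t, g s) + ∫ s in t..x, g s) := by
    intro x hx
    rw [← setIntegral_EIoo_eq_add (hτ t ht) (hτ x hx) (hgi t ht) (hgi x hx), ← integral_smul]
    refine setIntegral_congr_fun (measurableSet_EIoo τ x) fun s hs => ?_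
    simp only [hg, smul_smul, hfactor x hx s (hsub x hx hs)]
  have hd := ((hPd t ht).cexp.smul
    ((hasDerivWithinAt_integral_of_ordConnected hI hgc ht ht).const_add
      (∫ s in EIoo τ t, g s))).congr hu (hu t ht)
  refine hd.congr_deriv ?_
  rw [hu t ht]
  have hPt : P t = 0 := intervalIntegral.integral_same
  simp [hg, hPt, add_comm]

end

theorem continuousOn_f₄ {τ : EReal} {I : Set ℝ} (hI : I.OrdConnected)
    (hsub : ∀ t ∈ I, EIoo τ t ⊆ I) (hτ : ∀ t ∈ I, τ ≤ t) {α β ρ : ℝ → ℂ}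
    (hα : ContinuousOn α I) (hβ : ContinuousOn β I) (hρ : ContinuousOn ρ I)
    (hα0 : ∀ t ∈ I, α t ≠ 0)
    (hint : ∀ t ∈ I, IntegrableOn
      (fun s => Real.exp (-∫ μ in s..t, (ρ μ + β μ / α μ).re) / ‖α s‖) (EIoo τ t)) :
    ContinuousOn (f₄ τ α β ρ) I := by
  set p : ℝ → ℂ := fun t => ((-(ρ t + β t / α t).re : ℝ) : ℂ) with hp
  set h : ℝ → ℂ := fun t => ((‖α t‖⁻¹ : ℝ) : ℂ) with hh
  have hpc : ContinuousOn p I :=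
    Complex.continuous_ofReal.comp_continuousOn
      (Complex.continuous_re.comp_continuousOn (hρ.add (hβ.div hα hα0))).neg
  have hhc : ContinuousOn h I :=
    Complex.continuous_ofReal.comp_continuousOn
      (hα.norm.inv₀ fun t ht => norm_ne_zero_iff.2 (hα0 t ht))
  have hu : ∀ t, f₄ τ α β ρ t = (duhamel τ p h t).re := by
    intro t
    have : duhamel τ p h t = ((f₄ τ α β ρ t : ℝ) : ℂ) := by
      rw [duhamel, f₄, ← integral_complex_ofReal]
      refine integral_congr_ae (.of_forall fun s => ?_)
      simp only [hp, hh, smul_eq_mul, intervalIntegral.integral_ofReal,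
        intervalIntegral.integral_neg, div_eq_mul_inv]
      push_cast
      rfl
    rw [this, Complex.ofReal_re]
  refine (Complex.continuous_re.comp_continuousOn fun t ht =>
    (hasDerivWithinAt_duhamel (b := fun t => ‖α t‖⁻¹) hI hsub hpc hhc (fun t _ => ?_)
      (fun t ht => ?_) hτ ht).continuousWithinAt).congr fun t _ => hu t
  · simp [hh]
  · simpa only [hp, Complex.ofReal_re, intervalIntegral.integral_neg, div_eq_mul_inv]
      using hint t ht

/-- Theorem 3.1 (iii). -/
theorem ulam_stability_case_iii (n : ℕ) (τ σ : EReal) (hτσ : τ < σ) (I : Set ℝ)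
    (hI : I = {t : ℝ | τ < (t : EReal) ∧ (t : EReal) < σ} ∨
          I = {t : ℝ | τ < (t : EReal) ∧ (t : EReal) ≤ σ} ∨
          I = {t : ℝ | τ ≤ (t : EReal) ∧ (t : EReal) < σ} ∨
          I = {t : ℝ | τ ≤ (t : EReal) ∧ (t : EReal) ≤ σ})
    (α β γ : ℝ → ℂ) (f : ℝ → EuclideanSpace ℂ (Fin n))
    (hα : ContinuousOn α I) (hβ : ContinuousOn β I) (hγ : ContinuousOn γ I)
    (hf : ContinuousOn f I) (hα0 : ∀ t ∈ I, α t ≠ 0)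
    (ρ ρ' : ℝ → ℂ) (hρc : ContinuousOn ρ' I)
    (hρd : ∀ t ∈ I, HasDerivWithinAt ρ (ρ' t) I t)
    (hRic : ∀ t ∈ I, α t * (ρ' t + ρ t ^ 2) + β t * ρ t + γ t = 0)
    (hf₃int : ∀ t ∈ I, IntegrableOn
      (fun s => Real.exp (∫ μ in s..t, (ρ μ).re)) (EIoo τ t))
    (hf₄int : ∀ t ∈ I, IntegrableOn
      (fun s => Real.exp (-∫ μ in s..t, (ρ μ + β μ / α μ).re) / ‖α s‖) (EIoo τ t))
    (hf₃bdd : BddAbove (f₃ τ ρ '' I))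
    (hf₄bdd : BddAbove (f₄ τ α β ρ '' I)) :
    (∃ L, IsUlamConstant n I α β γ f L) ∧
      IsUlamConstant n I α β γ f
        (sSup ((fun t => ∫ s in EIoo τ t,
          (∫ μ in EIoo τ s, Real.exp (-∫ ν in μ..s, (ρ ν + β ν / α ν).re) / ‖α μ‖) *
            Real.exp (∫ μ in s..t, (ρ μ).re)) '' I)) := by
  have hIoc : I.OrdConnected := by
    refine ⟨fun x hx y hy z hz => ?_⟩
    have h₁ : (x : EReal) ≤ z := EReal.coe_le_coe_iff.2 hz.1
    have h₂ : (z : EReal) ≤ y := EReal.coe_le_coe_iff.2 hz.2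
    rcases hI with rfl | rfl | rfl | rfl
    exacts [⟨hx.1.trans_le h₁, h₂.trans_lt hy.2⟩, ⟨hx.1.trans_le h₁, h₂.trans hy.2⟩,
      ⟨hx.1.trans h₁, h₂.trans_lt hy.2⟩, ⟨hx.1.trans h₁, h₂.trans hy.2⟩]
  have hτI : ∀ t ∈ I, τ ≤ t := by
    intro t ht
    rcases hI with rfl | rfl | rfl | rfl
    exacts [ht.1.le, ht.1.le, ht.1, ht.1]
  have hsub : ∀ t ∈ I, EIoo τ t ⊆ I := by
    intro t ht s hs
    have h₁ : τ < (s : EReal) := hs.1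
    have h₂ : (s : EReal) < t := EReal.coe_lt_coe_iff.2 hs.2
    rcases hI with rfl | rfl | rfl | rfl
    exacts [⟨h₁, h₂.trans ht.2⟩, ⟨h₁, (h₂.trans_le ht.2).le⟩, ⟨h₁.le, h₂.trans ht.2⟩,
      ⟨h₁.le, (h₂.trans_le ht.2).le⟩]
  obtain ⟨t₁, ht₁, hτt₁⟩ : ∃ t ∈ I, τ < (t : EReal) := by
    obtain ⟨q, hq₁, hq₂⟩ := EReal.lt_iff_exists_real_btwn.1 hτσ
    refine ⟨q, ?_, hq₁⟩
    rcases hI with rfl | rfl | rfl | rfl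
    exacts [⟨hq₁, hq₂⟩, ⟨hq₁, hq₂.le⟩, ⟨hq₁.le, hq₂⟩, ⟨hq₁.le, hq₂.le⟩]
  have hρ : ContinuousOn ρ I := fun t ht => (hρd t ht).continuousWithinAt
  have hκ : ContinuousOn (fun t => -(ρ t + β t / α t)) I := (hρ.add (hβ.div hα hα0)).neg
  have hf₄c : ContinuousOn (f₄ τ α β ρ) I :=
    continuousOn_f₄ hIoc hsub hτI hα hβ hρ hα0 hf₄int
  have hf₄nonneg : ∀ t, 0 ≤ f₄ τ α β ρ t := fun t => integral_nonneg fun s => by positivity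
  obtain ⟨M, hM⟩ := hf₄bdd
  obtain ⟨N, hN⟩ := hf₃bdd
  have hM' : ∀ t ∈ I, f₄ τ α β ρ t ≤ M := fun t ht => hM (mem_image_of_mem _ ht)
  have hM0 : 0 ≤ M := (hf₄nonneg t₁).trans (hM' t₁ ht₁)
  have hint₃ : ∀ t ∈ I, IntegrableOn
      (fun s => f₄ τ α β ρ s * Real.exp (∫ μ in s..t, (ρ μ).re)) (EIoo τ t) := by
    intro t ht
    refine (hf₃int t ht).bdd_mul (c := M)
      ((hf₄c.mono (hsub t ht)).aestronglyMeasurable (measurableSet_EIoo τ t))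
      ((ae_restrict_iff' (measurableSet_EIoo τ t)).2 (.of_forall fun s hs => ?_))
    rw [Real.norm_of_nonneg (hf₄nonneg s)]
    exact hM' s (hsub t ht hs)
  change (∃ L, IsUlamConstant n I α β γ f L) ∧ IsUlamConstant n I α β γ f
    (sSup ((fun t => ∫ s in EIoo τ t,
      f₄ τ α β ρ s * Real.exp (∫ μ in s..t, (ρ μ).re)) '' I))
  set F : ℝ → ℝ := fun t => ∫ s in EIoo τ t,
    f₄ τ α β ρ s * Real.exp (∫ μ in s..t, (ρ μ).re) with hF
  have hFbdd : BddAbove (F '' I) := by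
    refine ⟨M * N, ?_⟩
    rintro _ ⟨t, ht, rfl⟩
    calc F t ≤ ∫ s in EIoo τ t, M * Real.exp (∫ μ in s..t, (ρ μ).re) :=
          setIntegral_mono_on (hint₃ t ht) ((hf₃int t ht).const_mul M) (measurableSet_EIoo τ t)
            fun s hs => mul_le_mul_of_nonneg_right (hM' s (hsub t ht hs)) (Real.exp_pos _).le
      _ = M * f₃ τ ρ t := integral_const_mul _ _
      _ ≤ M * N := mul_le_mul_of_nonneg_left (hN (mem_image_of_mem _ ht)) hM0
  have hFle : ∀ t ∈ I, F t ≤ sSup (F '' I) := fun t ht => le_csSup hFbdd (mem_image_of_mem _ ht)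
  have hFpos : 0 < F t₁ := by
    refine setIntegral_EIoo_pos hτt₁ (fun s hs => mul_pos ?_ (Real.exp_pos _)) (hint₃ t₁ ht₁)
    have hs' := hsub t₁ ht₁ hs
    exact setIntegral_EIoo_pos hs.1 (fun r hr => div_pos (Real.exp_pos _)
      (norm_pos_iff.2 (hα0 r (hsub s hs' hr)))) (hf₄int s hs')
  suffices hU : IsUlamConstant n I α β γ f (sSup (F '' I)) from ⟨⟨_, hU⟩, hU⟩
  refine ⟨hFpos.trans_le (hFle t₁ ht₁), fun ε hε ξ ξd ξdd hξ hξd hξddc hbound => ?_⟩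
  have hξc : ContinuousOn ξ I := fun t ht => (hξ t ht).continuousWithinAt
  have hξdc : ContinuousOn ξd I := fun t ht => (hξd t ht).continuousWithinAt
  set κ : ℝ → ℂ := fun t => -(ρ t + β t / α t) with hκdef
  set h : ℝ → EuclideanSpace ℂ (Fin n) :=
    fun t => (α t)⁻¹ • (α t • ξdd t + β t • ξd t + γ t • ξ t - f t) with hh
  have hhc : ContinuousOn h I :=
    (hα.inv₀ hα0).smul ((((hα.smul hξddc).add (hβ.smul hξdc)).add (hγ.smul hξc)).sub hf)
  have hhb : ∀ t ∈ I, ‖h t‖ ≤ ε * ‖α t‖⁻¹ := by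
    intro t ht
    rw [hh, norm_smul, norm_inv, mul_comm]
    gcongr
    exact hbound t ht
  have hker : ∀ t s, Real.exp (∫ μ in s..t, (κ μ).re) * (ε * ‖α s‖⁻¹)
      = ε * (Real.exp (-∫ μ in s..t, (ρ μ + β μ / α μ).re) / ‖α s‖) := by
    intro t s
    simp only [hκdef, Complex.neg_re, intervalIntegral.integral_neg]
    ring
  have hzint : ∀ t ∈ I, IntegrableOn
      (fun s => Real.exp (∫ μ in s..t, (κ μ).re) * (ε * ‖α s‖⁻¹)) (EIoo τ t) := by
    intro t ht
    simp only [hker]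
    exact (hf₄int t ht).const_mul ε
  set z := duhamel τ κ h with hz
  have hzd : ∀ t ∈ I, HasDerivWithinAt z (κ t • z t + h t) I t := fun t ht =>
    hasDerivWithinAt_duhamel hIoc hsub hκ hhc hhb hzint hτI ht
  have hzc : ContinuousOn z I := fun t ht => (hzd t ht).continuousWithinAt
  have hzb : ∀ t ∈ I, ‖z t‖ ≤ ε * f₄ τ α β ρ t := by
    intro t ht
    refine (norm_duhamel_le hIoc hsub hκ hhb hzint ht).trans_eq ?_
    simp only [hker]
    exact integral_const_mul _ _
  have hker' : ∀ t s, Real.exp (∫ μ in s..t, (ρ μ).re) * (ε * f₄ τ α β ρ s)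
      = ε * (f₄ τ α β ρ s * Real.exp (∫ μ in s..t, (ρ μ).re)) := fun t s => by ring
  have hyint : ∀ t ∈ I, IntegrableOn
      (fun s => Real.exp (∫ μ in s..t, (ρ μ).re) * (ε * f₄ τ α β ρ s)) (EIoo τ t) := by
    intro t ht
    simp only [hker']
    exact (hint₃ t ht).const_mul ε
  set y := duhamel τ ρ z with hy
  have hyd : ∀ t ∈ I, HasDerivWithinAt y (ρ t • y t + z t) I t := fun t ht =>
    hasDerivWithinAt_duhamel hIoc hsub hρ hzc hzb hyint hτI ht
  have hyc : ContinuousOn y I := fun t ht => (hyd t ht).continuousWithinAt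
  have hyb : ∀ t ∈ I, ‖y t‖ ≤ ε * F t := by
    intro t ht
    refine (norm_duhamel_le hIoc hsub hρ hzb hyint ht).trans_eq ?_
    simp only [hker']
    exact integral_const_mul _ _
  set yd : ℝ → EuclideanSpace ℂ (Fin n) := fun t => ρ t • y t + z t with hyd_def
  set ydd : ℝ → EuclideanSpace ℂ (Fin n) :=
    fun t => (ρ t • yd t + ρ' t • y t) + (κ t • z t + h t) with hydd_def
  have hydc : ContinuousOn yd I := (hρ.smul hyc).add hzc
  have hyddc : ContinuousOn ydd I :=
    ((hρ.smul hydc).add (hρc.smul hyc)).add ((hκ.smul hzc).add hhc)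
  refine ⟨ξ - y, ξd - yd, ξdd - ydd, fun t ht => (hξ t ht).sub (hyd t ht),
    fun t ht => (hξd t ht).sub (((hρd t ht).smul (hyd t ht)).add (hzd t ht)),
    hξddc.sub hyddc, fun t ht => ?_, fun t ht => ?_⟩
  · have hsolve : α t • ydd t + β t • yd t + γ t • y t
        = α t • ξdd t + β t • ξd t + γ t • ξ t - f t := by
      have hαh : α t • h t = α t • ξdd t + β t • ξd t + γ t • ξ t - f t := by
        rw [hh, smul_smul, mul_inv_cancel₀ (hα0 t ht), one_smul]
      rw [← hαh]
      have hακ : α t * κ t = -(α t * ρ t + β t) := by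
        have := hα0 t ht
        simp only [hκdef]
        field_simp
      have hγt : γ t = -(α t * (ρ' t + ρ t ^ 2) + β t * ρ t) := by
        linear_combination hRic t ht
      simp only [hydd_def, hyd_def, smul_add, smul_smul, hακ, hγt]
      module
    calc α t • (ξdd t - ydd t) + β t • (ξd t - yd t) + γ t • (ξ t - y t)
        = (α t • ξdd t + β t • ξd t + γ t • ξ t)
            - (α t • ydd t + β t • yd t + γ t • y t) := by module
      _ = f t := by rw [hsolve, sub_sub_cancel]
  · rw [Pi.sub_apply, sub_sub_cancel, mul_comm]
    exact (hyb t ht).trans (mul_le_mul_of_nonneg_left (hFle t ht) hε.le)
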